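/- Let λ < 1 be a constant and define U_λ[f](t) = t^{λ−1} ∫_0^t s^{−λ} f(s) ds on X = (0,∞) equipped with the measure ν(dt) = dt/t. Then |U_λ[f]|_{p,ν} ≤ (1−λ)^{−1} |f|_{p,ν} for all p ∈ [1,∞], so for every ψ ∈ Ψ(1,∞), ||U_λ[f]||G(ψ) ≤ (1−λ)^{−1} ||f||G(ψ); moreover the constant 1/(1−λ) is exact: sup_{ψ∈Ψ(1,∞)} sup_{f≠0} ||U_λ[f]||G(ψ) / ||f||G(ψ) = 1/(1−λ). -/

import Mathlib

open MeasureTheory Real Set Filter ENNReal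

/-- `ψ ∈ Ψ(I)`: continuous, positive, with positive infimum on the exponent set `I`. -/
def PsiClass (I : Set ℝ) (ψ : ℝ → ℝ) : Prop :=
  ContinuousOn ψ I ∧ (∀ p ∈ I, 0 < ψ p) ∧ ∃ ε > 0, ∀ p ∈ I, ε ≤ ψ p

/-- The measure `dν = dt/t` on `(0,∞)`. -/
noncomputable def nuMeasure : Measure ℝ :=
  (volume.restrict (Set.Ioi 0)).withDensity fun t => ENNReal.ofReal (1 / t)

/-- The Bilateral Grand Lebesgue norm `sup_{p ∈ I} |f|_{p,ν} / ψ(p)`. -/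
noncomputable def BGLS (I : Set ℝ) (ψ : ℝ → ℝ) (f : ℝ → ℝ) : ℝ≥0∞ :=
  ⨆ p ∈ I, eLpNorm f (ENNReal.ofReal p) nuMeasure / ENNReal.ofReal (ψ p)

lemma lintegral_nuMeasure (g : ℝ → ℝ≥0∞) :
    ∫⁻ t, g t ∂nuMeasure = ∫⁻ t in Ioi 0, ENNReal.ofReal (1 / t) * g t := by
  rw [nuMeasure, lintegral_withDensity_eq_lintegral_mul_non_measurable _ (by fun_prop)
    (by simp)]
  rfl

lemma ae_nuMeasure_iff {P : ℝ → Prop} :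
    (∀ᵐ t ∂nuMeasure, P t) ↔ ∀ᵐ t ∂volume.restrict (Ioi (0 : ℝ)), P t := by
  refine ⟨fun h => ?_, fun h => withDensity_absolutelyContinuous _ _ h⟩
  refine withDensity_absolutelyContinuous' (by fun_prop) ?_ h
  filter_upwards [ae_restrict_mem measurableSet_Ioi] with t ht
  have : 0 < t := ht
  simp [this]

/-- Jensen's inequality for powers, for a measure of arbitrary mass. -/
lemma rpow_lintegral_le_measure_univ_mul {α : Type*} [MeasurableSpace α] (μ : Measure α) {p : ℝ}
    (hp : 1 ≤ p) {h : α → ℝ≥0∞} (hh : AEMeasurable h μ) :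
    (∫⁻ x, h x ∂μ) ^ p ≤ μ univ ^ (p - 1) * ∫⁻ x, h x ^ p ∂μ := by
  have hp0 : 0 < p := by linarith
  have key := ENNReal.lintegral_mul_norm_pow_le (μ := μ) (f := fun x => h x ^ p) (g := fun _ => 1)
    (hh.pow_const p) aemeasurable_const (p := 1 / p) (q := 1 - 1 / p) (by positivity)
    (by rw [sub_nonneg, div_le_one hp0]; exact hp) (by ring)
  have hp1 : p * (1 / p) = 1 := by field_simp
  simp only [← ENNReal.rpow_mul, hp1, ENNReal.rpow_one, ENNReal.one_rpow, mul_one,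
    lintegral_one] at key
  calc (∫⁻ x, h x ∂μ) ^ p ≤ ((∫⁻ x, h x ^ p ∂μ) ^ (1 / p) * μ univ ^ (1 - 1 / p)) ^ p := by gcongr
    _ = μ univ ^ (p - 1) * ∫⁻ x, h x ^ p ∂μ := by
      rw [ENNReal.mul_rpow_of_nonneg _ _ hp0.le, ← ENNReal.rpow_mul, ← ENNReal.rpow_mul, mul_comm,
        mul_comm (1 / p) p, hp1, ENNReal.rpow_one]
      congr 2
      field_simp

lemma lintegral_Ioo_rpow {a : ℝ} (ha : -1 < a) {t : ℝ} (ht : 0 < t) :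
    ∫⁻ s in Ioo 0 t, ENNReal.ofReal (s ^ a) = ENNReal.ofReal (t ^ (a + 1) / (a + 1)) := by
  have hint := (intervalIntegrable_iff_integrableOn_Ioo_of_le ht.le).1
    (intervalIntegral.intervalIntegrable_rpow' (a := 0) (b := t) ha)
  rw [← ofReal_integral_eq_lintegral_ofReal hint, ← integral_Ioc_eq_integral_Ioo,
    ← intervalIntegral.integral_of_le ht.le, integral_rpow (Or.inl ha),
    Real.zero_rpow (by linarith), sub_zero]
  filter_upwards [ae_restrict_mem measurableSet_Ioo] with s hs
  exact Real.rpow_nonneg hs.1.le _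

lemma lintegral_Ioi_rpow {a : ℝ} (ha : a < -1) {s : ℝ} (hs : 0 < s) :
    ∫⁻ t in Ioi s, ENNReal.ofReal (t ^ a) = ENNReal.ofReal (-s ^ (a + 1) / (a + 1)) := by
  rw [← ofReal_integral_eq_lintegral_ofReal (integrableOn_Ioi_rpow_of_lt ha hs),
    integral_Ioi_rpow_of_lt ha hs]
  filter_upwards [ae_restrict_mem measurableSet_Ioi] with t ht
  exact Real.rpow_nonneg (hs.trans ht).le _

/-- The kernel of `U_λ`. -/
noncomputable def powerKernel (lam t s : ℝ) : ℝ≥0∞ :=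
  ENNReal.ofReal (t ^ (lam - 1)) * ENNReal.ofReal (s ^ (-lam))

lemma measurable_powerKernel (lam : ℝ) :
    Measurable (fun q : ℝ × ℝ => powerKernel lam q.1 q.2) := by
  unfold powerKernel
  fun_prop

lemma measurable_powerKernel_right (lam t : ℝ) : Measurable (powerKernel lam t) := by
  unfold powerKernel
  fun_prop

lemma lintegral_powerKernel {lam : ℝ} (hlam : lam < 1) {t : ℝ} (ht : 0 < t) :
    ∫⁻ s in Ioo 0 t, powerKernel lam t s = ENNReal.ofReal (1 / (1 - lam)) := by
  unfold powerKernel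
  rw [lintegral_const_mul _ (by fun_prop), lintegral_Ioo_rpow (by linarith) ht,
    ← ENNReal.ofReal_mul (by positivity), mul_div_assoc', ← Real.rpow_add ht]
  ring_nf
  simp

lemma lintegral_nuMeasure_powerKernel {lam : ℝ} (hlam : lam < 1) {s : ℝ} (hs : 0 < s) :
    ∫⁻ t in Ioi s, ENNReal.ofReal (1 / t) * powerKernel lam t s
      = ENNReal.ofReal (1 / (1 - lam)) * ENNReal.ofReal (1 / s) := by
  have h1 : ∀ t ∈ Ioi s, ENNReal.ofReal (1 / t) * powerKernel lam t s
      = ENNReal.ofReal (s ^ (-lam)) * ENNReal.ofReal (t ^ (lam - 2)) := by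
    intro t ht
    have ht0 : 0 < t := hs.trans ht
    rw [powerKernel, ← mul_assoc, mul_comm, ← ENNReal.ofReal_mul (by positivity),
      show lam - 2 = -1 + (lam - 1) by ring, Real.rpow_add ht0, Real.rpow_neg_one, one_div]
  rw [setLIntegral_congr_fun measurableSet_Ioi h1, lintegral_const_mul _ (by fun_prop),
    lintegral_Ioi_rpow (by linarith) hs, ← ENNReal.ofReal_mul (by positivity),
    ← ENNReal.ofReal_mul (by have := sub_pos.2 hlam; positivity)]
  congr 1
  have h2 : s ^ (-lam) * s ^ (lam - 1) = 1 / s := by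
    rw [← Real.rpow_add hs, show -lam + (lam - 1) = -1 by ring, Real.rpow_neg_one, one_div]
  rw [show lam - 2 + 1 = lam - 1 by ring, ← h2, neg_div, ← div_neg, neg_sub]
  ring

/-- Schur test for the kernel of `U_λ` on `L^p(dt/t)`. -/
lemma lintegral_rpow_powerKernel_le {lam : ℝ} (hlam : lam < 1) {p : ℝ} (hp : 1 ≤ p)
    {h : ℝ → ℝ≥0∞} (hh : Measurable h) :
    ∫⁻ t, (∫⁻ s in Ioo 0 t, powerKernel lam t s * h s) ^ p ∂nuMeasure
      ≤ ENNReal.ofReal (1 / (1 - lam)) ^ p * ∫⁻ t, h t ^ p ∂nuMeasure := by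
  set C := ENNReal.ofReal (1 / (1 - lam)) with hC
  have hC0 : C ≠ 0 := by
    have := sub_pos.2 hlam
    simp [hC, this]
  have hK := measurable_powerKernel lam
  set F : ℝ → ℝ → ℝ≥0∞ := fun t s => {q : ℝ × ℝ | q.2 < q.1}.indicator
    (fun q => ENNReal.ofReal (1 / q.1) * powerKernel lam q.1 q.2 * h q.2 ^ p) (t, s) with hF
  have hFm : Measurable (Function.uncurry F) :=
    Measurable.indicator (by fun_prop) (measurableSet_lt measurable_snd measurable_fst)
  have hjensen : ∀ t ∈ Ioi (0 : ℝ),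
      ENNReal.ofReal (1 / t) * (∫⁻ s in Ioo 0 t, powerKernel lam t s * h s) ^ p
        ≤ C ^ (p - 1) * ∫⁻ s in Ioi 0, F t s := by
    intro t ht
    have hkm := measurable_powerKernel_right lam t
    have hj := rpow_lintegral_le_measure_univ_mul
      ((volume.restrict (Ioo 0 t)).withDensity (powerKernel lam t)) hp hh.aemeasurable
    rw [lintegral_withDensity_eq_lintegral_mul _ hkm hh,
      lintegral_withDensity_eq_lintegral_mul _ hkm (hh.pow_const p),
      withDensity_apply _ MeasurableSet.univ, Measure.restrict_univ,
      lintegral_powerKernel hlam ht] at hj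
    have hFt : ∫⁻ s in Ioi 0, F t s
        = ENNReal.ofReal (1 / t) * ∫⁻ s in Ioo 0 t, powerKernel lam t s * h s ^ p := by
      rw [← lintegral_const_mul _ (by fun_prop), ← Ioi_inter_Iio, inter_comm,
        ← setLIntegral_indicator measurableSet_Iio]
      congr 1
      ext s
      simp [hF, indicator_apply, mul_assoc]
    rw [hFt, mul_left_comm]
    gcongr
    exact hj
  have hinner : ∀ s ∈ Ioi (0 : ℝ),
      ∫⁻ t in Ioi 0, F t s = C * (ENNReal.ofReal (1 / s) * h s ^ p) := by
    intro s hs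
    have hs' : Ioi s ∩ Ioi 0 = Ioi s := inter_eq_left.2 (Ioi_subset_Ioi (le_of_lt hs))
    have : ∀ t, F t s
        = (Ioi s).indicator (fun t => ENNReal.ofReal (1 / t) * powerKernel lam t s * h s ^ p) t := by
      intro t
      simp [hF, indicator_apply]
    simp_rw [this]
    rw [setLIntegral_indicator measurableSet_Ioi, hs', lintegral_mul_const _ (by fun_prop),
      lintegral_nuMeasure_powerKernel hlam hs, mul_assoc]
  rw [lintegral_nuMeasure, lintegral_nuMeasure]
  calc _ ≤ ∫⁻ t in Ioi 0, C ^ (p - 1) * ∫⁻ s in Ioi 0, F t s :=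
        setLIntegral_mono' measurableSet_Ioi hjensen
    _ = C ^ (p - 1) * ∫⁻ s in Ioi 0, ∫⁻ t in Ioi 0, F t s := by
      rw [lintegral_const_mul' _ _ (ENNReal.rpow_ne_top_of_nonneg (by linarith)
        ENNReal.ofReal_ne_top), lintegral_lintegral_swap hFm.aemeasurable]
    _ = C ^ (p - 1) * (C * ∫⁻ s in Ioi 0, ENNReal.ofReal (1 / s) * h s ^ p) := by
      rw [setLIntegral_congr_fun measurableSet_Ioi hinner, lintegral_const_mul _ (by fun_prop)]
    _ = _ := by
      rw [← mul_assoc, ENNReal.rpow_sub _ _ hC0 ENNReal.ofReal_ne_top, ENNReal.rpow_one,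
        ENNReal.div_mul_cancel hC0 ENNReal.ofReal_ne_top]

/-- Even when `f` is not measurable, `U_λ f` only sees a measurable part of `f`. -/
lemma exists_measurable_minorant (lam : ℝ) (f : ℝ → ℝ) :
    ∃ h : ℝ → ℝ≥0∞, Measurable h ∧ (∀ᵐ s, h s ≤ ‖f s‖ₑ) ∧
      ∀ t, 0 < t → ‖t ^ (lam - 1) * ∫ s in Ioo (0 : ℝ) t, s ^ (-lam) * f s‖ₑ
        ≤ ∫⁻ s in Ioo 0 t, powerKernel lam t s * h s := by
  set T := {t : ℝ | AEMeasurable f (volume.restrict (Ioo 0 t))} with hT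
  set S := ⋃ t ∈ T, Ioo 0 t with hS
  have hSm : MeasurableSet S := (isOpen_biUnion fun _ _ => isOpen_Ioo).measurableSet
  have hfS : AEMeasurable f (volume.restrict S) := by
    obtain ⟨R, hRT, hR, hRS⟩ := TopologicalSpace.isOpen_biUnion_countable T (fun t => Ioo 0 t)
      fun _ _ => isOpen_Ioo
    rw [hS, ← hRS, biUnion_eq_iUnion]
    have := hR.to_subtype
    exact AEMeasurable.iUnion fun t => hRT t.2
  have hmk := (ae_restrict_iff' hSm).1 hfS.ae_eq_mk
  refine ⟨S.indicator fun s => ‖hfS.mk f s‖ₑ, hfS.measurable_mk.enorm.indicator hSm, ?_, ?_⟩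
  · filter_upwards [hmk] with s hs
    by_cases hsS : s ∈ S
    · simp [hsS, hs hsS]
    · simp [hsS]
  · intro t ht
    by_cases hm : AEStronglyMeasurable (fun s => s ^ (-lam) * f s) (volume.restrict (Ioo 0 t))
    · have htT : t ∈ T := by
        have hmul : AEMeasurable (fun s => s ^ lam * (s ^ (-lam) * f s))
            (volume.restrict (Ioo 0 t)) :=
          AEMeasurable.mul (by fun_prop) hm.aemeasurable
        refine hmul.congr ?_
        filter_upwards [ae_restrict_mem measurableSet_Ioo] with s hs
        rw [← mul_assoc, ← Real.rpow_add hs.1, add_neg_cancel, Real.rpow_zero, one_mul]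
      have hsub : Ioo 0 t ⊆ S := subset_biUnion_of_mem (u := fun t : ℝ => Ioo 0 t) htT
      rw [enorm_mul, Real.enorm_of_nonneg (by positivity)]
      unfold powerKernel
      simp_rw [mul_assoc]
      rw [lintegral_const_mul' _ _ ENNReal.ofReal_ne_top]
      gcongr
      refine (enorm_integral_le_lintegral_enorm _).trans (lintegral_mono_ae ?_)
      filter_upwards [ae_restrict_mem measurableSet_Ioo, ae_restrict_of_ae hmk] with s hs hs'
      rw [enorm_mul, Real.enorm_of_nonneg (Real.rpow_nonneg hs.1.le _),
        indicator_of_mem (hsub hs), ← hs' (hsub hs)]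
    · rw [integral_non_aestronglyMeasurable hm]
      simp

lemma eLpNorm_U_lambda_le {lam : ℝ} (hlam : lam < 1) {p : ℝ≥0∞} (hp : 1 ≤ p) (f : ℝ → ℝ) :
    eLpNorm (fun t => t ^ (lam - 1) * ∫ s in Ioo (0 : ℝ) t, s ^ (-lam) * f s) p nuMeasure
      ≤ ENNReal.ofReal (1 / (1 - lam)) * eLpNorm f p nuMeasure := by
  obtain ⟨h, hh, hle, hU⟩ := exists_measurable_minorant lam f
  rcases eq_or_ne p ∞ with rfl | hp_top
  · rw [eLpNorm_exponent_top, eLpNorm_exponent_top]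
    refine eLpNormEssSup_le_of_ae_enorm_bound ?_
    have hsup : ∀ᵐ s, s ∈ Ioi (0 : ℝ) → ‖f s‖ₑ ≤ eLpNormEssSup f nuMeasure :=
      (ae_restrict_iff' measurableSet_Ioi).1 (ae_nuMeasure_iff.1 ae_le_eLpNormEssSup)
    rw [ae_nuMeasure_iff]
    filter_upwards [ae_restrict_mem measurableSet_Ioi] with t ht
    refine (hU t ht).trans ?_
    calc _ ≤ ∫⁻ s in Ioo 0 t, powerKernel lam t s * eLpNormEssSup f nuMeasure := by
          refine lintegral_mono_ae ?_
          filter_upwards [ae_restrict_mem measurableSet_Ioo, ae_restrict_of_ae hle,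
            ae_restrict_of_ae hsup] with s hs h1 h2
          gcongr
          exact h1.trans (h2 hs.1)
      _ = _ := by
          rw [lintegral_mul_const _ (measurable_powerKernel_right lam t),
            lintegral_powerKernel hlam ht]
  · have hp0 : p ≠ 0 := (zero_lt_one.trans_le hp).ne'
    have hpr : 1 ≤ p.toReal := by
      rwa [← ENNReal.ofReal_le_iff_le_toReal hp_top, ENNReal.ofReal_one]
    have hpr0 : 0 < p.toReal := by linarith
    rw [eLpNorm_eq_lintegral_rpow_enorm_toReal hp0 hp_top,
      eLpNorm_eq_lintegral_rpow_enorm_toReal hp0 hp_top, one_div, ENNReal.rpow_inv_le_iff hpr0,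
      ENNReal.mul_rpow_of_nonneg _ _ hpr0.le, ENNReal.rpow_inv_rpow hpr0.ne']
    calc _ ≤ ∫⁻ t, (∫⁻ s in Ioo 0 t, powerKernel lam t s * h s) ^ p.toReal ∂nuMeasure := by
          refine lintegral_mono_ae (ae_nuMeasure_iff.2 ?_)
          filter_upwards [ae_restrict_mem measurableSet_Ioi] with t ht
          gcongr
          exact hU t ht
      _ ≤ _ := lintegral_rpow_powerKernel_le hlam hpr hh
      _ ≤ _ := by
          gcongr 1
          refine lintegral_mono_ae (ae_nuMeasure_iff.2 ?_)
          filter_upwards [ae_restrict_of_ae hle] with t ht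
          gcongr

lemma BGLS_le_of_eLpNorm_le {I : Set ℝ} (ψ : ℝ → ℝ) {f g : ℝ → ℝ} {C : ℝ≥0∞}
    (h : ∀ p ∈ I, eLpNorm g (ENNReal.ofReal p) nuMeasure
      ≤ C * eLpNorm f (ENNReal.ofReal p) nuMeasure) :
    BGLS I ψ g ≤ C * BGLS I ψ f := by
  refine iSup₂_le fun p hp => ?_
  calc _ ≤ C * eLpNorm f (ENNReal.ofReal p) nuMeasure / ENNReal.ofReal (ψ p) := by
        gcongr
        exact h p hp
    _ = C * (eLpNorm f (ENNReal.ofReal p) nuMeasure / ENNReal.ofReal (ψ p)) := mul_div_assoc _ _ _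
    _ ≤ _ := by
        gcongr
        exact le_iSup₂ (f := fun p (_ : p ∈ I) =>
          eLpNorm f (ENNReal.ofReal p) nuMeasure / ENNReal.ofReal (ψ p)) p hp

/-- The nearly extremal functions for `U_λ`. -/
noncomputable def truncatedPower (ε : ℝ) : ℝ → ℝ := (Ioo 0 1).indicator fun t => t ^ ε

lemma truncatedPower_nonneg (ε t : ℝ) : 0 ≤ truncatedPower ε t :=
  indicator_nonneg (fun _ hs => Real.rpow_nonneg hs.1.le _) t

lemma truncatedPower_le_one {ε : ℝ} (hε : 0 < ε) (t : ℝ) : truncatedPower ε t ≤ 1 :=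
  indicator_le' (fun _ hs => Real.rpow_le_one hs.1.le hs.2.le hε.le) (fun _ _ => zero_le_one) t

lemma measurable_truncatedPower (ε : ℝ) : Measurable (truncatedPower ε) :=
  Measurable.indicator (by fun_prop) measurableSet_Ioo

lemma lintegral_truncatedPower {ε : ℝ} (hε : 0 < ε) :
    ∫⁻ t, ‖truncatedPower ε t‖ₑ ∂nuMeasure = ENNReal.ofReal (1 / ε) := by
  rw [lintegral_nuMeasure]
  have h1 : ∀ t ∈ Ioi (0 : ℝ), ENNReal.ofReal (1 / t) * ‖truncatedPower ε t‖ₑ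
      = (Iio 1).indicator (fun t => ENNReal.ofReal (t ^ (ε - 1))) t := by
    intro t ht
    have ht0 : 0 < t := ht
    rw [Real.enorm_of_nonneg (truncatedPower_nonneg ε t)]
    by_cases h : t < 1
    · rw [truncatedPower, indicator_of_mem (mem_Ioo.2 ⟨ht0, h⟩), indicator_of_mem (mem_Iio.2 h),
        ← ENNReal.ofReal_mul (by positivity), Real.rpow_sub_one ht0.ne']
      congr 1
      ring
    · simp [truncatedPower, h]
  rw [setLIntegral_congr_fun measurableSet_Ioi h1, setLIntegral_indicator measurableSet_Iio,
    inter_comm, Ioi_inter_Iio, lintegral_Ioo_rpow (by linarith) one_pos]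
  simp

lemma BGLS_truncatedPower_ne_top {ε : ℝ} (hε : 0 < ε) :
    BGLS (Ioi 1) (fun _ => 1) (truncatedPower ε) ≠ ∞ := by
  refine ne_top_of_le_ne_top (b := max 1 (ENNReal.ofReal (1 / ε))) (by simp) (iSup₂_le fun p hp => ?_)
  have hp1 : 1 < p := hp
  have hp0 : 0 < p := by linarith
  rw [ENNReal.ofReal_one, div_one, eLpNorm_eq_lintegral_rpow_enorm_toReal (by simpa) (by simp),
    ENNReal.toReal_ofReal hp0.le, one_div, ENNReal.rpow_inv_le_iff hp0]
  calc _ ≤ ∫⁻ t, ‖truncatedPower ε t‖ₑ ∂nuMeasure := by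
        refine lintegral_mono fun t => ?_
        refine ENNReal.rpow_le_self_of_le_one ?_ hp1.le
        rw [Real.enorm_of_nonneg (truncatedPower_nonneg ε t)]
        simpa using truncatedPower_le_one hε t
    _ = ENNReal.ofReal (1 / ε) := lintegral_truncatedPower hε
    _ ≤ max 1 (ENNReal.ofReal (1 / ε)) := le_max_right _ _
    _ ≤ _ := ENNReal.le_rpow_self_of_one_le (le_max_left _ _) hp1.le

lemma BGLS_truncatedPower_ne_zero {ε : ℝ} (hε : 0 < ε) :
    BGLS (Ioi 1) (fun _ => 1) (truncatedPower ε) ≠ 0 := by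
  intro h0
  have h2 : eLpNorm (truncatedPower ε) (ENNReal.ofReal 2) nuMeasure / ENNReal.ofReal 1 ≤ 0 :=
    h0 ▸ le_iSup₂ (f := fun p (_ : p ∈ Ioi (1 : ℝ)) =>
      eLpNorm (truncatedPower ε) (ENNReal.ofReal p) nuMeasure / ENNReal.ofReal 1) 2
      (by norm_num : (2 : ℝ) ∈ Ioi 1)
  rw [ENNReal.ofReal_one, div_one, nonpos_iff_eq_zero, eLpNorm_eq_zero_iff
    (measurable_truncatedPower ε).aestronglyMeasurable (by simp)] at h2
  have h3 := lintegral_truncatedPower hε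
  rw [lintegral_congr_ae (g := fun _ => 0) (h2.mono fun t ht => by simp [ht]), lintegral_zero,
    eq_comm, ENNReal.ofReal_eq_zero] at h3
  have : 0 < 1 / ε := by positivity
  linarith

lemma truncatedPower_le_U_lambda {lam ε : ℝ} (hlam : lam < 1) (hε : 0 < ε) (t : ℝ) :
    ‖truncatedPower ε t‖ ≤ (1 - lam + ε) *
      ‖t ^ (lam - 1) * ∫ s in Ioo (0 : ℝ) t, s ^ (-lam) * truncatedPower ε s‖ := by
  have hc : 0 < 1 - lam + ε := by linarith
  by_cases ht : t ∈ Ioo (0 : ℝ) 1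
  · have ht0 : 0 < t := ht.1
    have h1 : ∀ s ∈ Ioo 0 t, s ^ (-lam) * truncatedPower ε s = s ^ (ε - lam) := by
      intro s hs
      rw [truncatedPower, indicator_of_mem (mem_Ioo.2 ⟨hs.1, hs.2.trans ht.2⟩),
        ← Real.rpow_add hs.1]
      congr 1
      ring
    rw [setIntegral_congr_fun measurableSet_Ioo h1, ← integral_Ioc_eq_integral_Ioo,
      ← intervalIntegral.integral_of_le ht0.le, integral_rpow (Or.inl (by linarith)),
      Real.zero_rpow (by linarith), sub_zero, mul_div_assoc', ← Real.rpow_add ht0,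
      show lam - 1 + (ε - lam + 1) = ε by ring, show ε - lam + 1 = 1 - lam + ε by ring,
      truncatedPower, indicator_of_mem ht, norm_div, Real.norm_of_nonneg hc.le,
      mul_div_cancel₀ _ hc.ne']
  · rw [truncatedPower, indicator_of_notMem ht, norm_zero]
    positivity

/-- Theorem 7: `|U_λ f|_{p,ν} ≤ (1-λ)⁻¹ |f|_{p,ν}` for all `p ∈ [1,∞]`,
hence `‖U_λ f‖G(ψ) ≤ (1-λ)⁻¹ ‖f‖G(ψ)`, and the constant `1/(1-λ)` is exact. -/
theorem U_lambda_bgls_exact_constant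
    (lam : ℝ) (hlam : lam < 1)
    (U : (ℝ → ℝ) → ℝ → ℝ)
    (hU : ∀ f t, U f t = t ^ (lam - 1) * ∫ s in Set.Ioo (0:ℝ) t, s ^ (-lam) * f s) :
    -- the `L^p(ν)` estimate for all `p ∈ [1,∞]`
    (∀ p : ℝ≥0∞, 1 ≤ p → ∀ f : ℝ → ℝ,
      eLpNorm (U f) p nuMeasure ≤ ENNReal.ofReal (1/(1 - lam)) * eLpNorm f p nuMeasure) ∧
    -- the BGLS estimate
    (∀ ψ : ℝ → ℝ, PsiClass (Set.Ioi 1) ψ → ∀ f : ℝ → ℝ,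
      BGLS (Set.Ioi 1) ψ (U f) ≤ ENNReal.ofReal (1/(1 - lam)) * BGLS (Set.Ioi 1) ψ f) ∧
    -- exactness of the constant `1/(1-λ)`
    (⨆ ψ : ℝ → ℝ, ⨆ _ : PsiClass (Set.Ioi 1) ψ, ⨆ f : ℝ → ℝ, ⨆ _ : f ≠ 0,
      BGLS (Set.Ioi 1) ψ (U f) / BGLS (Set.Ioi 1) ψ f) = ENNReal.ofReal (1/(1 - lam)) := by
  have hUf : ∀ f, U f = fun t => t ^ (lam - 1) * ∫ s in Ioo (0 : ℝ) t, s ^ (-lam) * f s :=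
    fun f => funext (hU f)
  have hLp : ∀ p : ℝ≥0∞, 1 ≤ p → ∀ f : ℝ → ℝ, eLpNorm (U f) p nuMeasure
      ≤ ENNReal.ofReal (1 / (1 - lam)) * eLpNorm f p nuMeasure := by
    intro p hp f
    rw [hUf]
    exact eLpNorm_U_lambda_le hlam hp f
  have hG : ∀ ψ : ℝ → ℝ, ∀ f : ℝ → ℝ, BGLS (Ioi 1) ψ (U f)
      ≤ ENNReal.ofReal (1 / (1 - lam)) * BGLS (Ioi 1) ψ f :=
    fun ψ f => BGLS_le_of_eLpNorm_le ψ fun p hp =>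
      hLp _ (ENNReal.one_le_ofReal.2 (le_of_lt hp)) f
  refine ⟨hLp, fun ψ _ f => hG ψ f, le_antisymm ?_ ?_⟩
  · exact iSup₂_le fun ψ _ => iSup₂_le fun f _ => ENNReal.div_le_of_le_mul (hG ψ f)
  · have hlim : Tendsto (fun ε : ℝ => ENNReal.ofReal (1 / (1 - lam + ε))) (nhdsWithin 0 (Ioi 0))
        (nhds (ENNReal.ofReal (1 / (1 - lam)))) := by
      refine (ENNReal.continuous_ofReal.tendsto _).comp (Tendsto.mono_left ?_ nhdsWithin_le_nhds)
      have hc : ContinuousAt (fun ε : ℝ => 1 / (1 - lam + ε)) 0 :=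
        ContinuousAt.div (by fun_prop) (by fun_prop) (by simpa using (sub_pos.2 hlam).ne')
      simpa [ContinuousAt] using hc
    refine le_of_tendsto hlim ?_
    filter_upwards [self_mem_nhdsWithin] with ε hε
    have hε0 : 0 < ε := hε
    have hc : 0 < 1 - lam + ε := by linarith
    have hψ : PsiClass (Ioi 1) fun _ => 1 :=
      ⟨continuousOn_const, fun _ _ => one_pos, 1, one_pos, fun _ _ => le_rfl⟩
    have h0 := BGLS_truncatedPower_ne_zero hε0
    have hne : truncatedPower ε ≠ 0 := by
      intro h
      apply h0
      simp [h, BGLS]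
    refine le_trans ?_ (le_iSup₂_of_le (fun _ => 1) hψ
      (le_iSup₂_of_le (truncatedPower ε) hne le_rfl))
    rw [ENNReal.le_div_iff_mul_le (Or.inl h0) (Or.inl (BGLS_truncatedPower_ne_top hε0)), one_div,
      ENNReal.ofReal_inv_of_pos hc, mul_comm, ← div_eq_mul_inv]
    refine ENNReal.div_le_of_le_mul' (BGLS_le_of_eLpNorm_le _ fun p _ => ?_)
    refine eLpNorm_le_mul_eLpNorm_of_ae_le_mul (Eventually.of_forall fun t => ?_) _
    rw [hUf]
    exact truncatedPower_le_U_lambda hlam hε0 t
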